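/- arXiv:2603.15931 — 7 statements merged into one kernel-verified Lean document; each statement's English description precedes it below -/
import Mathlib

section
/- Strictly propagative eigenspace bounds: In the block operator setting, assume the data is strictly propagative (each A_i for i ≥ 2 is bijective) and let λ ∈ ℂ. Then dim E_i = dim E_1 for all i ≥ 1, and dim E_1 ≤ dim ker(Φ − λ·id_V) ≤ dim ker(M − λ·id_{E'}) + dim E_1. -/
/-!
Block operator setting (see the paper): `E'` is a finite-dimensional ℂ-vector space,
`E i` (for `i : ℕ`) denotes the cusp layer `E_{i+1}` of the paper (indices shifted by one),
and `V = E' × ∏ i, E i`.  The operator `Φ` is described componentwise by `hΦ1`–`hΦ3`.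
Strictly propagative: every `Aseq i` (i.e. every `A_i`, `i ≥ 2`) is bijective.
Conclusion: `dim E_i = dim E_1` for all `i ≥ 1`, and
`dim E_1 ≤ dim ker (Φ - λ) ≤ dim ker (M - λ) + dim E_1`.
-/

/-- A dependent sequence can be built from its first two terms and a two-step recursion. -/
theorem exists_seq_of_two_step {E : ℕ → Type*} (x₀ : E 0) (x₁ : E 1)
    (g : ∀ j, E j → E (j + 1) → E (j + 2)) :
    ∃ v : ∀ i, E i, v 0 = x₀ ∧ v 1 = x₁ ∧ ∀ j, v (j + 2) = g j (v j) (v (j + 1)) := by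
  let p : ∀ n, E n × E (n + 1) := fun n =>
    Nat.rec (motive := fun n => E n × E (n + 1)) (x₀, x₁) (fun j q => (q.2, g j q.1 q.2)) n
  exact ⟨fun n => (p n).1, rfl, rfl, fun _ => rfl⟩

section KernelCoprod

variable {K V W : Type*} [Field K] [AddCommGroup V] [Module K V] [FiniteDimensional K V]
  [AddCommGroup W] [Module K W] [FiniteDimensional K W]

theorem LinearMap.finrank_le_finrank_ker_coprod (f : V →ₗ[K] V) (g : W →ₗ[K] V) :
    Module.finrank K W ≤ Module.finrank K (LinearMap.ker (f.coprod g)) := by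
  have h := (f.coprod g).finrank_range_add_finrank_ker
  rw [Module.finrank_prod] at h
  have := Submodule.finrank_le (LinearMap.range (f.coprod g))
  lia

theorem LinearMap.finrank_ker_coprod_le (f : V →ₗ[K] V) (g : W →ₗ[K] V) :
    Module.finrank K (LinearMap.ker (f.coprod g)) ≤
      Module.finrank K (LinearMap.ker f) + Module.finrank K W := by
  have h := (f.coprod g).finrank_range_add_finrank_ker
  rw [Module.finrank_prod] at h
  have hf := f.finrank_range_add_finrank_ker
  have hle : LinearMap.range f ≤ LinearMap.range (f.coprod g) := by
    rw [LinearMap.range_coprod]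
    exact le_sup_left
  have := Submodule.finrank_mono hle
  lia

end KernelCoprod

theorem strictly_propagative_eigenspace_bounds
    (E' : Type) [AddCommGroup E'] [Module ℂ E'] [FiniteDimensional ℂ E']
    (E : ℕ → Type) [∀ i, AddCommGroup (E i)] [∀ i, Module ℂ (E i)]
    [∀ i, FiniteDimensional ℂ (E i)]
    (M : E' →ₗ[ℂ] E') (A : E 0 →ₗ[ℂ] E') (B : E' →ₗ[ℂ] E 0)
    (Mseq : ∀ i, E i →ₗ[ℂ] E i)
    (Aseq : ∀ i, E (i + 1) →ₗ[ℂ] E i)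
    (Bseq : ∀ i, E i →ₗ[ℂ] E (i + 1))
    (Φ : (E' × (∀ i, E i)) →ₗ[ℂ] (E' × (∀ i, E i)))
    (hΦ1 : ∀ v : E' × (∀ i, E i), (Φ v).1 = M v.1 + A (v.2 0))
    (hΦ2 : ∀ v : E' × (∀ i, E i),
      (Φ v).2 0 = B v.1 + Mseq 0 (v.2 0) + Aseq 0 (v.2 1))
    (hΦ3 : ∀ (v : E' × (∀ i, E i)) (j : ℕ),
      (Φ v).2 (j + 1)
        = Bseq j (v.2 j) + Mseq (j + 1) (v.2 (j + 1)) + Aseq (j + 1) (v.2 (j + 2)))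
    (hstrict : ∀ i, Function.Bijective (Aseq i))
    (lam : ℂ) :
    (∀ i, Module.finrank ℂ (E i) = Module.finrank ℂ (E 0)) ∧
    (Module.finrank ℂ (E 0) : Cardinal)
        ≤ Module.rank ℂ (LinearMap.ker (Φ - lam • LinearMap.id)) ∧
    Module.rank ℂ (LinearMap.ker (Φ - lam • LinearMap.id))
        ≤ Module.rank ℂ (LinearMap.ker (M - lam • LinearMap.id))
            + (Module.finrank ℂ (E 0) : Cardinal) := by
  have hmem : ∀ v, v ∈ LinearMap.ker (Φ - lam • LinearMap.id) ↔
      (M v.1 + A (v.2 0) = lam • v.1 ∧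
        B v.1 + Mseq 0 (v.2 0) + Aseq 0 (v.2 1) = lam • v.2 0 ∧
        ∀ j, Bseq j (v.2 j) + Mseq (j + 1) (v.2 (j + 1)) + Aseq (j + 1) (v.2 (j + 2)) =
          lam • v.2 (j + 1)) := by
    intro v
    have hker : v ∈ LinearMap.ker (Φ - lam • LinearMap.id) ↔ Φ v = lam • v := by
      simp [LinearMap.mem_ker, sub_eq_zero]
    rw [hker, ← hΦ1, ← hΦ2]
    simp only [← hΦ3]
    constructor
    · intro h
      simp [h]
    · rintro ⟨h₁, h₂, h₃⟩
      refine Prod.ext h₁ (funext fun i => ?_)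
      cases i with
      | zero => exact h₂
      | succ j => exact h₃ j
  let T : E' × E 0 →ₗ[ℂ] E' := (M - lam • LinearMap.id).coprod A
  have hT : ∀ x, x ∈ LinearMap.ker T ↔ M x.1 + A x.2 = lam • x.1 := by
    intro x
    simp only [T, LinearMap.mem_ker, LinearMap.coprod_apply, LinearMap.sub_apply,
      LinearMap.smul_apply, LinearMap.id_apply]
    rw [← sub_eq_zero (a := M x.1 + A x.2), add_sub_right_comm]
  let R : E' × (∀ i, E i) →ₗ[ℂ] E' × E 0 := LinearMap.id.prodMap (LinearMap.proj 0)
  let r : LinearMap.ker (Φ - lam • LinearMap.id) →ₗ[ℂ] LinearMap.ker T :=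
    R.restrict fun v hv => (hT _).2 ((hmem v).1 hv).1
  have hinj : Function.Injective r := by
    rw [injective_iff_map_eq_zero]
    rintro ⟨⟨x, v⟩, hv⟩ h
    obtain ⟨-, h₂, h₃⟩ := (hmem _).1 hv
    have hR : R (x, v) = 0 := congrArg Subtype.val h
    have hx : x = 0 := congrArg Prod.fst hR
    have hv₀ : v 0 = 0 := congrArg Prod.snd hR
    have hzero : ∀ j, v j = 0 ∧ v (j + 1) = 0 := by
      intro j
      induction j with
      | zero =>
        refine ⟨hv₀, (hstrict 0).1 ?_⟩
        simpa [hx, hv₀] using h₂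
      | succ j ih =>
        refine ⟨ih.2, (hstrict (j + 1)).1 ?_⟩
        simpa [ih.1, ih.2] using h₃ j
    exact Subtype.ext (Prod.ext hx (funext fun i => (hzero i).1))
  have hsurj : Function.Surjective r := by
    rintro ⟨⟨x, y⟩, hxy⟩
    choose S hS using fun i => (hstrict i).2
    obtain ⟨v, rfl, hv₁, hv⟩ := exists_seq_of_two_step y
      (S 0 (lam • y - (B x + Mseq 0 y)))
      (fun j a b => S (j + 1) (lam • b - (Bseq j a + Mseq (j + 1) b)))
    refine ⟨⟨(x, v), (hmem _).2 ⟨(hT _).1 hxy, ?_, fun j => ?_⟩⟩, rfl⟩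
    · simp [hv₁, hS]
    · simp [hv, hS]
  have e := LinearEquiv.ofBijective r ⟨hinj, hsurj⟩
  refine ⟨fun i => ?_, ?_, ?_⟩
  · induction i with
    | zero => rfl
    | succ i ih => rw [← ih, (LinearEquiv.ofBijective (Aseq i) (hstrict i)).finrank_eq]
  · rw [e.rank_eq, ← Module.finrank_eq_rank]
    exact_mod_cast LinearMap.finrank_le_finrank_ker_coprod _ A
  · rw [e.rank_eq, ← Module.finrank_eq_rank, ← Module.finrank_eq_rank]
    exact_mod_cast LinearMap.finrank_ker_coprod_le _ A
end

section
/- Eigenvectors are determined by their first cusp layer: In the block operator setting, assume the data is strictly propagative (each A_i for i ≥ 2 is bijective) and let λ ∈ ℂ be not an eigenvalue of M : E' → E'. Then the restriction map ker(Φ − λ·id_V) → E_1 sending an eigenvector v = (v', v_1, v_2, …) to its component v_1 is a ℂ-linear isomorphism. -/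
/-!
Block operator setting (`E i` is the paper's cusp layer `E_{i+1}`), `Φ` described
componentwise by `hΦ1`–`hΦ3`, strictly propagative data, `λ` not an eigenvalue of `M`.
Conclusion: the ℂ-linear restriction map `ker (Φ - λ) → E_1`, `v ↦ v_1`
(here: `v ↦ v.2 0`), is bijective, i.e. a ℂ-linear isomorphism.
-/

/-- Existence of dependent sequences satisfying a second-order recursion. -/
theorem exists_second_order_recursion {E : ℕ → Type*} (x₀ : E 0) (x₁ : E 1)
    (f : ∀ n, E n → E (n + 1) → E (n + 2)) :
    ∃ u : ∀ n, E n, u 0 = x₀ ∧ u 1 = x₁ ∧ ∀ n, u (n + 2) = f n (u n) (u (n + 1)) := by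
  let P : ∀ n, E n × E (n + 1) :=
    fun n => Nat.rec (x₀, x₁) (fun n p => (p.2, f n p.1 p.2)) n
  exact ⟨fun n => (P n).1, rfl, rfl, fun _ => rfl⟩

/-- On a finite-dimensional space, `f - μ` is bijective when `μ` is not an eigenvalue of `f`. -/
theorem bijective_sub_smul_id_of_not_hasEigenvalue {K V : Type*} [Field K] [AddCommGroup V]
    [Module K V] [FiniteDimensional K V] {f : Module.End K V} {μ : K}
    (h : ¬ f.HasEigenvalue μ) :
    Function.Bijective (f - μ • LinearMap.id : V →ₗ[K] V) := by
  have hinj : Function.Injective (f - μ • LinearMap.id : V →ₗ[K] V) := by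
    rw [injective_iff_map_eq_zero]
    intro x hx
    by_contra hx0
    refine h (Module.End.hasEigenvalue_of_hasEigenvector
      ⟨Module.End.mem_eigenspace_iff.2 ?_, hx0⟩)
    simpa [sub_eq_zero] using hx
  exact ⟨hinj, LinearMap.injective_iff_surjective.1 hinj⟩

theorem eigenvectors_determined_by_first_cusp_layer
    (E' : Type) [AddCommGroup E'] [Module ℂ E'] [FiniteDimensional ℂ E']
    (E : ℕ → Type) [∀ i, AddCommGroup (E i)] [∀ i, Module ℂ (E i)]
    [∀ i, FiniteDimensional ℂ (E i)]
    (M : E' →ₗ[ℂ] E') (A : E 0 →ₗ[ℂ] E') (B : E' →ₗ[ℂ] E 0)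
    (Mseq : ∀ i, E i →ₗ[ℂ] E i)
    (Aseq : ∀ i, E (i + 1) →ₗ[ℂ] E i)
    (Bseq : ∀ i, E i →ₗ[ℂ] E (i + 1))
    (Φ : (E' × (∀ i, E i)) →ₗ[ℂ] (E' × (∀ i, E i)))
    (hΦ1 : ∀ v : E' × (∀ i, E i), (Φ v).1 = M v.1 + A (v.2 0))
    (hΦ2 : ∀ v : E' × (∀ i, E i),
      (Φ v).2 0 = B v.1 + Mseq 0 (v.2 0) + Aseq 0 (v.2 1))
    (hΦ3 : ∀ (v : E' × (∀ i, E i)) (j : ℕ),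
      (Φ v).2 (j + 1)
        = Bseq j (v.2 j) + Mseq (j + 1) (v.2 (j + 1)) + Aseq (j + 1) (v.2 (j + 2)))
    (hstrict : ∀ i, Function.Bijective (Aseq i))
    (lam : ℂ) (hlam : ¬ Module.End.HasEigenvalue M lam) :
    Function.Bijective
      (((LinearMap.proj 0 : (∀ i, E i) →ₗ[ℂ] E 0).comp
        ((LinearMap.snd ℂ E' (∀ i, E i)).comp
          (LinearMap.ker (Φ - lam • LinearMap.id)).subtype))) := by
  have hM := bijective_sub_smul_id_of_not_hasEigenvalue hlam
  constructor
  · rw [injective_iff_map_eq_zero]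
    rintro ⟨⟨v', u⟩, hv⟩ h0
    replace h0 : u 0 = 0 := h0
    have hΦv : Φ (v', u) = lam • (v', u) := by
      simpa [sub_eq_zero] using hv
    have h1 := hΦ1 (v', u)
    have h2 := hΦ2 (v', u)
    have h3 := hΦ3 (v', u)
    simp only [hΦv, Prod.smul_mk, Pi.smul_apply, h0, map_zero, smul_zero, add_zero] at h1 h2 h3
    have hv' : v' = 0 := hM.1 (by simp [← h1])
    have hu1 : u 1 = 0 := (hstrict 0).1 (by simpa [hv'] using h2.symm)
    have hu : ∀ n, u n = 0 ∧ u (n + 1) = 0 := by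
      intro n
      induction n with
      | zero => exact ⟨h0, hu1⟩
      | succ n ih =>
        exact ⟨ih.2, (hstrict (n + 1)).1 (by simpa [ih.1, ih.2] using (h3 n).symm)⟩
    exact Subtype.ext (Prod.ext hv' (funext fun n => (hu n).1))
  · intro x
    choose g hg using fun i => (hstrict i).2
    obtain ⟨v', hv'⟩ := hM.2 (-A x)
    obtain ⟨u, hu0, hu1, hu⟩ := exists_second_order_recursion x
      (g 0 (lam • x - B v' - Mseq 0 x))
      (fun n y z => g (n + 1) (lam • z - Bseq n y - Mseq (n + 1) z))
    refine ⟨⟨(v', u), ?_⟩, hu0⟩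
    rw [LinearMap.mem_ker, LinearMap.sub_apply, sub_eq_zero]
    refine Prod.ext ?_ (funext fun n => ?_)
    · have h : M v' - lam • v' = -A x := hv'
      simp only [hΦ1, hu0, LinearMap.smul_apply, LinearMap.id_apply, Prod.smul_mk]
      rw [← sub_eq_zero, add_sub_right_comm, h, neg_add_cancel]
    · cases n with
      | zero =>
        simp only [hΦ2, hu0, hu1, hg, LinearMap.smul_apply, LinearMap.id_apply, Prod.smul_mk,
          Pi.smul_apply]
        abel
      | succ n =>
        simp only [hΦ3, hu, hg, LinearMap.smul_apply, LinearMap.id_apply, Prod.smul_mk,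
          Pi.smul_apply]
        abel
end

section
/- Eigenforms form a trivial algebraic family: In the block operator setting, assume the data is strictly propagative (each A_i for i ≥ 2 is bijective). For λ ∈ ℂ with det(λ·id_{E'} − M) ≠ 0 and w ∈ E_1, let v(λ, w) ∈ ker(Φ − λ·id_V) denote the unique λ-eigenvector whose E_1-component equals w. Then the eigenvector depends rationally on λ and linearly on w: there exists a finite family of ℂ-linear maps P'_k : E_1 → E' such that det(λ·id_{E'} − M)·v(λ,w)' = Σ_k λ^k P'_k(w) for all such λ and all w, and for every i ≥ 1 there exists a finite family of ℂ-linear maps P_{i,k} : E_1 → E_i such that det(λ·id_{E'} − M)·v(λ,w)_i = Σ_k λ^k P_{i,k}(w) for all such λ and all w. -/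
/-!
Block operator setting (`E i` is the paper's cusp layer `E_{i+1}`), `Φ` described
componentwise by `hΦ1`–`hΦ3`, strictly propagative data.
For `λ` with `det (λ·id - M) ≠ 0` the λ-eigenvector with prescribed first cusp
component `w` is unique; we express this by quantifying over all `v` with
`Φ v = λ • v` and `v.2 0 = w`.  Conclusion: the eigenvector depends rationally on `λ`
and linearly on `w`:
there are finitely many linear maps `P'_k : E_1 → E'` with
`det (λ·id - M) • v' = Σ_k λ^k • P'_k w`, and for each cusp layer `i` finitely many
linear maps `P_{i,k} : E_1 → E_i` with `det (λ·id - M) • v_i = Σ_k λ^k • P_{i,k} w`.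
-/

/-- The polynomial functions `ℂ → V` of one complex variable with coefficients in `V`. -/
noncomputable def polynomialFamilies (V : Type*) [AddCommGroup V] [Module ℂ V] :
    Submodule ℂ (ℂ → V) :=
  LinearMap.range (Finsupp.lsum ℂ fun k : ℕ =>
    LinearMap.pi fun z : ℂ => z ^ k • (LinearMap.id : V →ₗ[ℂ] V))

namespace polynomialFamilies

variable {V W : Type*} [AddCommGroup V] [Module ℂ V] [AddCommGroup W] [Module ℂ W]

theorem monomial_mem (k : ℕ) (x : V) : (fun z : ℂ => z ^ k • x) ∈ polynomialFamilies V :=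
  ⟨Finsupp.single k x, by ext z; simp⟩

theorem induction {p : (ℂ → V) → Prop} {F : ℂ → V} (hF : F ∈ polynomialFamilies V)
    (zero : p 0) (add : ∀ G H, p G → p H → p (G + H))
    (monomial : ∀ (k : ℕ) (x : V), p fun z => z ^ k • x) : p F := by
  obtain ⟨c, rfl⟩ := hF
  induction c using Finsupp.induction_linear with
  | zero => simpa using zero
  | add a b ha hb => rw [map_add]; exact add _ _ ha hb
  | single k x =>
    convert monomial k x using 1
    ext z
    simp

theorem exists_eq_sum {F : ℂ → V} (hF : F ∈ polynomialFamilies V) :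
    ∃ (N : ℕ) (c : ℕ → V), ∀ z, F z = ∑ k ∈ Finset.range N, z ^ k • c k := by
  obtain ⟨c, rfl⟩ := hF
  refine ⟨c.support.sup id + 1, c, fun z => ?_⟩
  have hsupp : c.support ⊆ Finset.range (c.support.sup id + 1) := fun k hk =>
    Finset.mem_range.2 (Nat.lt_succ_of_le (Finset.le_sup (f := id) hk))
  rw [Finsupp.lsum_apply, Finsupp.sum_of_support_subset c hsupp _ (by simp)]
  simp

theorem map_mem (T : V →ₗ[ℂ] W) {F : ℂ → V} (hF : F ∈ polynomialFamilies V) :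
    (fun z => T (F z)) ∈ polynomialFamilies W := by
  refine induction (p := fun F => (fun z => T (F z)) ∈ polynomialFamilies W) hF ?_ ?_ ?_
  · simp only [Pi.zero_apply, map_zero]
    exact zero_mem _
  · intro G H hG hH
    simp only [Pi.add_apply, map_add]
    exact add_mem hG hH
  · intro k x
    simpa using monomial_mem k (T x)

theorem var_smul_mem {F : ℂ → V} (hF : F ∈ polynomialFamilies V) :
    (fun z => z • F z) ∈ polynomialFamilies V := by
  refine induction (p := fun F => (fun z => z • F z) ∈ polynomialFamilies V) hF ?_ ?_ ?_
  · simp only [Pi.zero_apply, smul_zero]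
    exact zero_mem _
  · intro G H hG hH
    simp only [Pi.add_apply, smul_add]
    exact add_mem hG hH
  · intro k x
    simpa [smul_smul, pow_succ'] using monomial_mem (k + 1) x

theorem eval_smul_mem (p : Polynomial ℂ) (x : V) :
    (fun z => p.eval z • x) ∈ polynomialFamilies V := by
  induction p using Polynomial.induction_on' with
  | add p q hp hq =>
    simp only [Polynomial.eval_add, add_smul]
    exact add_mem hp hq
  | monomial k a => simpa [smul_smul, mul_comm] using monomial_mem k (a • x)

/-- The quotient `(p(z) - p(M)) / (z - M)` is polynomial in `z`. -/
theorem exists_eval_sub_aeval_eq_mul (p : Polynomial ℂ) (M : Module.End ℂ V) :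
    ∃ R ∈ polynomialFamilies (Module.End ℂ V), ∀ z : ℂ,
      p.eval z • (1 : Module.End ℂ V) - Polynomial.aeval M p = R z * (z • 1 - M) := by
  induction p using Polynomial.induction_on' with
  | add p q hp hq =>
    obtain ⟨R, hR, hRe⟩ := hp
    obtain ⟨S, hS, hSe⟩ := hq
    refine ⟨R + S, add_mem hR hS, fun z => ?_⟩
    rw [Pi.add_apply, add_mul, ← hRe, ← hSe, Polynomial.eval_add, map_add]
    module
  | monomial n a =>
    refine ⟨∑ i ∈ Finset.range n, fun z => z ^ i • (a • M ^ (n - 1 - i)),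
      sum_mem fun i _ => monomial_mem i _, fun z => ?_⟩
    have h := ((Commute.one_left M).smul_left z).geom_sum₂_mul n
    have hs : (∑ i ∈ Finset.range n, fun z : ℂ => z ^ i • (a • M ^ (n - 1 - i))) z =
        a • ∑ i ∈ Finset.range n, (z • (1 : Module.End ℂ V)) ^ i * M ^ (n - 1 - i) := by
      simp [Finset.sum_apply, Finset.smul_sum, smul_pow, smul_comm a]
    rw [hs, smul_mul_assoc, h]
    simp [Polynomial.aeval_monomial, smul_pow, smul_sub, smul_smul,
      Algebra.algebraMap_eq_smul_one]

end polynomialFamilies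

open polynomialFamilies in
/-- Up to the factor `det (z - M)`, the resolvent of `M` is polynomial in `z`. -/
theorem exists_resolvent_family {V : Type*} [AddCommGroup V] [Module ℂ V]
    [FiniteDimensional ℂ V] (M : V →ₗ[ℂ] V) :
    ∃ R ∈ polynomialFamilies (Module.End ℂ V), ∀ (z : ℂ) (x : V),
      M.charpoly.eval z • x = R z (z • x - M x) := by
  obtain ⟨R, hR, h⟩ := exists_eval_sub_aeval_eq_mul M.charpoly M
  refine ⟨R, hR, fun z x => ?_⟩
  simpa [LinearMap.aeval_self_charpoly] using LinearMap.congr_fun (h z) x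

theorem eigenforms_trivial_algebraic_family
    (E' : Type) [AddCommGroup E'] [Module ℂ E'] [FiniteDimensional ℂ E']
    (E : ℕ → Type) [∀ i, AddCommGroup (E i)] [∀ i, Module ℂ (E i)]
    [∀ i, FiniteDimensional ℂ (E i)]
    (M : E' →ₗ[ℂ] E') (A : E 0 →ₗ[ℂ] E') (B : E' →ₗ[ℂ] E 0)
    (Mseq : ∀ i, E i →ₗ[ℂ] E i)
    (Aseq : ∀ i, E (i + 1) →ₗ[ℂ] E i)
    (Bseq : ∀ i, E i →ₗ[ℂ] E (i + 1))
    (Φ : (E' × (∀ i, E i)) →ₗ[ℂ] (E' × (∀ i, E i)))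
    (hΦ1 : ∀ v : E' × (∀ i, E i), (Φ v).1 = M v.1 + A (v.2 0))
    (hΦ2 : ∀ v : E' × (∀ i, E i),
      (Φ v).2 0 = B v.1 + Mseq 0 (v.2 0) + Aseq 0 (v.2 1))
    (hΦ3 : ∀ (v : E' × (∀ i, E i)) (j : ℕ),
      (Φ v).2 (j + 1)
        = Bseq j (v.2 j) + Mseq (j + 1) (v.2 (j + 1)) + Aseq (j + 1) (v.2 (j + 2)))
    (hstrict : ∀ i, Function.Bijective (Aseq i)) :
    (∃ N : ℕ, ∃ P' : ℕ → (E 0 →ₗ[ℂ] E'),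
      ∀ lam : ℂ,
        LinearMap.det (lam • (LinearMap.id : E' →ₗ[ℂ] E') - M) ≠ 0 →
        ∀ (w : E 0) (v : E' × (∀ i, E i)),
          Φ v = lam • v → v.2 0 = w →
          LinearMap.det (lam • (LinearMap.id : E' →ₗ[ℂ] E') - M) • v.1
            = ∑ k ∈ Finset.range N, lam ^ k • P' k w) ∧
    (∀ i : ℕ, ∃ N : ℕ, ∃ P : ℕ → (E 0 →ₗ[ℂ] E i),
      ∀ lam : ℂ,
        LinearMap.det (lam • (LinearMap.id : E' →ₗ[ℂ] E') - M) ≠ 0 →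
        ∀ (w : E 0) (v : E' × (∀ i, E i)),
          Φ v = lam • v → v.2 0 = w →
          LinearMap.det (lam • (LinearMap.id : E' →ₗ[ℂ] E') - M) • v.2 i
            = ∑ k ∈ Finset.range N, lam ^ k • P k w) := by
  have hdet (z : ℂ) : LinearMap.det (z • (LinearMap.id : E' →ₗ[ℂ] E') - M)
      = M.charpoly.eval z := by
    rw [LinearMap.eval_charpoly, Algebra.algebraMap_eq_smul_one]
    rfl
  simp only [hdet]
  obtain ⟨R, hR, hRM⟩ := exists_resolvent_family M
  have hbase : ∃ F ∈ polynomialFamilies (E 0 →ₗ[ℂ] E'), ∀ (z : ℂ) v, Φ v = z • v →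
      M.charpoly.eval z • v.1 = F z (v.2 0) := by
    refine ⟨_, polynomialFamilies.map_mem (LinearMap.lcomp ℂ E' A) hR, fun z v hv => ?_⟩
    have h := hΦ1 v
    rw [hv, Prod.smul_fst] at h
    rw [hRM, h, add_sub_cancel_left, LinearMap.lcomp_apply]
  have hzero : ∃ F ∈ polynomialFamilies (E 0 →ₗ[ℂ] E 0), ∀ (z : ℂ) v, Φ v = z • v →
      M.charpoly.eval z • v.2 0 = F z (v.2 0) :=
    ⟨_, polynomialFamilies.eval_smul_mem M.charpoly LinearMap.id, fun z v _ => by simp⟩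
  -- the recursion expressing one layer through the two preceding ones
  have hstep {X : Type} [AddCommGroup X] [Module ℂ X] (j : ℕ) (C : X →ₗ[ℂ] E j)
      (π : (E' × ∀ i, E i) → X)
      (hrec : ∀ v, (Φ v).2 j = C (π v) + Mseq j (v.2 j) + Aseq j (v.2 (j + 1)))
      (hX : ∃ F ∈ polynomialFamilies (E 0 →ₗ[ℂ] X), ∀ (z : ℂ) v, Φ v = z • v →
        M.charpoly.eval z • π v = F z (v.2 0))
      (hj : ∃ F ∈ polynomialFamilies (E 0 →ₗ[ℂ] E j), ∀ (z : ℂ) v, Φ v = z • v →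
        M.charpoly.eval z • v.2 j = F z (v.2 0)) :
      ∃ F ∈ polynomialFamilies (E 0 →ₗ[ℂ] E (j + 1)), ∀ (z : ℂ) v, Φ v = z • v →
        M.charpoly.eval z • v.2 (j + 1) = F z (v.2 0) := by
    obtain ⟨F, hF, hFv⟩ := hX
    obtain ⟨G, hG, hGv⟩ := hj
    let e := LinearEquiv.ofBijective (Aseq j) (hstrict j)
    refine ⟨_, polynomialFamilies.map_mem (LinearMap.compRight ℂ e.symm.toLinearMap)
      (sub_mem (sub_mem (polynomialFamilies.var_smul_mem hG)
        (polynomialFamilies.map_mem (LinearMap.compRight ℂ (Mseq j)) hG))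
        (polynomialFamilies.map_mem (LinearMap.compRight ℂ C) hF)), fun z v hv => ?_⟩
    have h := hrec v
    rw [hv, Prod.smul_snd, Pi.smul_apply] at h
    have hA : e (v.2 (j + 1)) = z • v.2 j - Mseq j (v.2 j) - C (π v) := by
      rw [h, LinearEquiv.ofBijective_apply]
      abel
    apply e.injective
    rw [map_smul, hA]
    simp [← hFv z v hv, ← hGv z v hv, smul_sub, smul_comm z]
  have hlayer (i : ℕ) : ∃ F ∈ polynomialFamilies (E 0 →ₗ[ℂ] E i), ∀ (z : ℂ) v, Φ v = z • v →
      M.charpoly.eval z • v.2 i = F z (v.2 0) := by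
    induction i using Nat.twoStepInduction with
    | zero => exact hzero
    | one => exact hstep 0 B Prod.fst hΦ2 hbase hzero
    | more j hj hj' => exact hstep (j + 1) (Bseq j) (fun v => v.2 j) (fun v => hΦ3 v j) hj hj'
  refine ⟨?_, fun i => ?_⟩
  · obtain ⟨F, hF, hFv⟩ := hbase
    obtain ⟨N, P, hP⟩ := polynomialFamilies.exists_eq_sum hF
    refine ⟨N, P, fun z _ w v hv hw => ?_⟩
    simp [hFv z v hv, hw, hP]
  · obtain ⟨F, hF, hFv⟩ := hlayer i
    obtain ⟨N, P, hP⟩ := polynomialFamilies.exists_eq_sum hF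
    refine ⟨N, P, fun z _ w v hv hw => ?_⟩
    simp [hFv z v hv, hw, hP]
end

section
/- Surjectivity of Φ − λ: In the block operator setting, assume the data is strictly propagative (each A_i for i ≥ 2 is bijective) and let λ ∈ ℂ be not an eigenvalue of M : E' → E'. Then for every g ∈ V and every w ∈ E_1 there exists a unique f ∈ V with (Φ − λ·id_V)(f) = g and with E_1-component f_1 = w. In particular, the operator Φ − λ·id_V : V → V is surjective, and for each g ∈ V the solution set of (Φ − λ)(f) = g is an affine subspace of V of dimension dim E_1. -/
/-!
Block operator setting (`E i` is the paper's cusp layer `E_{i+1}`), `Φ` described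
componentwise by `hΦ1`–`hΦ3`, strictly propagative data, `λ` not an eigenvalue of `M`.
Conclusions: for every `g ∈ V` and `w ∈ E_1` there is a unique `f` with
`(Φ - λ) f = g` and `f_1 = w`; the operator `Φ - λ·id` is surjective; the solution
set of `(Φ - λ) f = g` is the coset `f₀ + ker (Φ - λ)` of the kernel, whose
dimension equals `dim E_1`.
-/

/-- A second-order recurrence in a family of types has a unique solution with given
initial values. -/
theorem existsUnique_of_two_step_recurrence {E : ℕ → Type*}
    (F : ∀ j, E j → E (j + 1) → E (j + 2)) (x : E 0) (y : E 1) :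
    ∃! f : ∀ i, E i, f 0 = x ∧ f 1 = y ∧ ∀ j, f (j + 2) = F j (f j) (f (j + 1)) := by
  let p : ∀ n, E n × E (n + 1) := fun n =>
    Nat.rec (motive := fun n => E n × E (n + 1)) (x, y) (fun j q => (q.2, F j q.1 q.2)) n
  refine ⟨fun n => (p n).1, ⟨rfl, rfl, fun _ => rfl⟩, ?_⟩
  rintro f ⟨h0, h1, hf⟩
  have key : ∀ n, f n = (p n).1 ∧ f (n + 1) = (p n).2 := by
    intro n
    induction n with
    | zero => exact ⟨h0, h1⟩
    | succ k ih =>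
      refine ⟨ih.2, (hf k).trans ?_⟩
      rw [ih.1, ih.2]
  exact funext fun n => (key n).1

/-- In finite dimension, `M - μ` is bijective when `μ` is not an eigenvalue of `M`. -/
theorem Module.End.bijective_sub_smul_of_not_hasEigenvalue {K V : Type*} [Field K]
    [AddCommGroup V] [Module K V] [FiniteDimensional K V] {M : Module.End K V} {μ : K}
    (h : ¬ M.HasEigenvalue μ) : Function.Bijective fun x => M x - μ • x := by
  have hinj : Function.Injective (M - algebraMap K (Module.End K V) μ) := by
    rw [← LinearMap.ker_eq_bot, Algebra.algebraMap_eq_smul_one, ← Module.End.eigenspace_def]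
    simpa [Module.End.hasEigenvalue_iff] using h
  exact ⟨hinj, LinearMap.injective_iff_surjective.mp hinj⟩

theorem phi_minus_lambda_surjective
    (E' : Type) [AddCommGroup E'] [Module ℂ E'] [FiniteDimensional ℂ E']
    (E : ℕ → Type) [∀ i, AddCommGroup (E i)] [∀ i, Module ℂ (E i)]
    [∀ i, FiniteDimensional ℂ (E i)]
    (M : E' →ₗ[ℂ] E') (A : E 0 →ₗ[ℂ] E') (B : E' →ₗ[ℂ] E 0)
    (Mseq : ∀ i, E i →ₗ[ℂ] E i)
    (Aseq : ∀ i, E (i + 1) →ₗ[ℂ] E i)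
    (Bseq : ∀ i, E i →ₗ[ℂ] E (i + 1))
    (Φ : (E' × (∀ i, E i)) →ₗ[ℂ] (E' × (∀ i, E i)))
    (hΦ1 : ∀ v : E' × (∀ i, E i), (Φ v).1 = M v.1 + A (v.2 0))
    (hΦ2 : ∀ v : E' × (∀ i, E i),
      (Φ v).2 0 = B v.1 + Mseq 0 (v.2 0) + Aseq 0 (v.2 1))
    (hΦ3 : ∀ (v : E' × (∀ i, E i)) (j : ℕ),
      (Φ v).2 (j + 1)
        = Bseq j (v.2 j) + Mseq (j + 1) (v.2 (j + 1)) + Aseq (j + 1) (v.2 (j + 2)))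
    (hstrict : ∀ i, Function.Bijective (Aseq i))
    (lam : ℂ) (hlam : ¬ Module.End.HasEigenvalue M lam) :
    (∀ (g : E' × (∀ i, E i)) (w : E 0),
      ∃! f : E' × (∀ i, E i), Φ f - lam • f = g ∧ f.2 0 = w) ∧
    Function.Surjective ⇑((Φ - lam • LinearMap.id : (E' × (∀ i, E i)) →ₗ[ℂ] (E' × (∀ i, E i)))) ∧
    (∀ g : E' × (∀ i, E i), ∃ f₀ : E' × (∀ i, E i),
      Φ f₀ - lam • f₀ = g ∧
      {f : E' × (∀ i, E i) | Φ f - lam • f = g}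
        = (fun v => f₀ + v) '' (LinearMap.ker (Φ - lam • LinearMap.id) : Set (E' × (∀ i, E i)))) ∧
    Module.rank ℂ (LinearMap.ker (Φ - lam • LinearMap.id))
      = Module.finrank ℂ (E 0) := by
  have hex : ∀ (g : E' × (∀ i, E i)) (w : E 0),
      ∃! f : E' × (∀ i, E i), Φ f - lam • f = g ∧ f.2 0 = w := by
    intro g w
    have hM := Module.End.bijective_sub_smul_of_not_hasEigenvalue hlam
    obtain ⟨x, hx⟩ := hM.2 (g.1 - A w)
    obtain ⟨y, hy⟩ := (hstrict 0).2 (g.2 0 - B x - Mseq 0 w + lam • w)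
    choose S hS using fun i => (hstrict i).2
    obtain ⟨s, ⟨hs0, hs1, hs⟩, huniq⟩ := existsUnique_of_two_step_recurrence
      (fun j a b => S (j + 1) (g.2 (j + 1) - Bseq j a - Mseq (j + 1) b + lam • b)) w y
    refine ⟨(x, s), ⟨Prod.ext ?_ (funext fun i => ?_), hs0⟩, ?_⟩
    · simp only [Prod.fst_sub, Prod.smul_fst, hΦ1, hs0]
      rw [add_sub_right_comm]
      exact (congrArg (· + A w) hx).trans (sub_add_cancel _ _)
    · cases i with
      | zero =>
        simp only [Prod.snd_sub, Prod.smul_snd, Pi.sub_apply, Pi.smul_apply, hΦ2, hs0, hs1, hy]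
        abel
      | succ j =>
        simp only [Prod.snd_sub, Prod.smul_snd, Pi.sub_apply, Pi.smul_apply, hΦ3, hs j, hS]
        abel
    · rintro f ⟨hf, hw⟩
      have hf1 : f.1 = x := by
        apply hM.1
        have h := congrArg Prod.fst hf
        simp only [Prod.fst_sub, Prod.smul_fst, hΦ1, hw] at h
        simp only [hx, ← h]
        abel
      refine Prod.ext hf1 (huniq _ ⟨hw, ?_, fun j => ?_⟩)
      · apply (hstrict 0).1
        have h := congrFun (congrArg Prod.snd hf) 0
        simp only [Prod.snd_sub, Prod.smul_snd, Pi.sub_apply, Pi.smul_apply, hΦ2, hw, hf1] at h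
        rw [hy, ← h]
        abel
      · apply (hstrict (j + 1)).1
        have h := congrFun (congrArg Prod.snd hf) (j + 1)
        simp only [Prod.snd_sub, Prod.smul_snd, Pi.sub_apply, Pi.smul_apply, hΦ3] at h
        rw [hS, ← h]
        abel
  refine ⟨hex, fun g => ?_, fun g => ?_, ?_⟩
  · obtain ⟨f, ⟨hf, -⟩, -⟩ := hex g 0
    exact ⟨f, hf⟩
  · obtain ⟨f₀, ⟨hf₀, -⟩, -⟩ := hex g 0
    refine ⟨f₀, hf₀, Set.ext fun f => ⟨fun hf => ⟨f - f₀, ?_, by simp⟩, ?_⟩⟩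
    · have h : Φ f - lam • f - (Φ f₀ - lam • f₀) = 0 := by
        rw [hf₀, sub_eq_zero]; exact hf
      rw [SetLike.mem_coe, LinearMap.mem_ker, map_sub]
      exact h
    · rintro ⟨v, hv, rfl⟩
      have hv' : Φ v - lam • v = 0 := hv
      simp only [Set.mem_ofPred_eq, map_add, smul_add]
      rw [add_sub_add_comm, hf₀, hv', add_zero]
  · let e : LinearMap.ker (Φ - lam • LinearMap.id) →ₗ[ℂ] E 0 :=
      (LinearMap.proj 0 ∘ₗ LinearMap.snd ℂ E' (∀ i, E i)) ∘ₗ Submodule.subtype _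
    have he : Function.Bijective e := by
      refine ⟨fun u v huv => Subtype.ext ?_, fun w => ?_⟩
      · exact (hex 0 (v.1.2 0)).unique ⟨u.2, huv⟩ ⟨v.2, rfl⟩
      · obtain ⟨f, ⟨hf, hw⟩, -⟩ := hex 0 w
        exact ⟨⟨f, hf⟩, hw⟩
    rw [(LinearEquiv.ofBijective e he).rank_eq, Module.finrank_eq_rank]
end

section
/- Generalized eigenspaces: In the block operator setting, assume the data is strictly propagative (each A_i for i ≥ 2 is bijective) and let λ ∈ ℂ be not an eigenvalue of M : E' → E'. Then for every integer k ≥ 1, dim( ker(Φ − λ)^k / ker(Φ − λ)^{k−1} ) = dim ker(Φ − λ), and consequently dim ker(Φ − λ·id_V)^k = k · dim ker(Φ − λ·id_V) = k · dim E_1. -/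
/-!
Block operator setting (`E i` is the paper's cusp layer `E_{i+1}`), `Φ` described
componentwise by `hΦ1`–`hΦ3`, strictly propagative data, `λ` not an eigenvalue of `M`.
Conclusion: for every `k ≥ 1`,
`dim (ker (Φ-λ)^k / ker (Φ-λ)^(k-1)) = dim ker (Φ-λ)`, and consequently
`dim ker (Φ-λ)^k = k · dim ker (Φ-λ) = k · dim E_1`.
-/

section SurjectiveEndomorphism

universe u v

variable {K : Type u} {V : Type v} [Field K] [AddCommGroup V] [Module K V]

/-- For a surjective endomorphism `T`, the power `T ^ n` identifies the quotient of
`ker (T ^ (n + 1))` by `ker (T ^ n)` with `ker T`. -/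
theorem rank_ker_pow_succ_quotient {T : V →ₗ[K] V} (hT : Function.Surjective T) (n : ℕ) :
    Module.rank K (LinearMap.ker (T ^ (n + 1)) ⧸
      Submodule.comap (LinearMap.ker (T ^ (n + 1))).subtype (LinearMap.ker (T ^ n)))
      = Module.rank K (LinearMap.ker T) := by
  let f : LinearMap.ker (T ^ (n + 1)) →ₗ[K] LinearMap.ker T :=
    ((T ^ n).domRestrict _).codRestrict _ fun x =>
      (LinearMap.congr_fun (pow_succ' T n) (x : V)).symm.trans x.2
  have hker : LinearMap.ker f
      = Submodule.comap (LinearMap.ker (T ^ (n + 1))).subtype (LinearMap.ker (T ^ n)) := by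
    ext x
    exact Subtype.ext_iff
  have hf : Function.Surjective f := by
    rintro ⟨y, hy⟩
    have hpow : Function.Surjective (T ^ n) := by
      rw [Module.End.coe_pow]
      exact hT.iterate n
    obtain ⟨x, hx⟩ := hpow y
    refine ⟨⟨x, ?_⟩, Subtype.ext hx⟩
    rw [LinearMap.mem_ker, pow_succ', Module.End.mul_apply, hx]
    exact hy
  rw [← hker]
  exact (f.quotKerEquivOfSurjective hf).rank_eq

theorem rank_ker_pow_of_surjective {T : V →ₗ[K] V} (hT : Function.Surjective T) (n : ℕ) :
    Module.rank K (LinearMap.ker (T ^ n)) = n * Module.rank K (LinearMap.ker T) := by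
  induction n with
  | zero =>
    have hbot : LinearMap.ker (T ^ 0) = ⊥ := by
      rw [pow_zero]
      exact LinearMap.ker_id
    rw [hbot, rank_bot, Nat.cast_zero, zero_mul]
  | succ n ih =>
    have hle : LinearMap.ker (T ^ n) ≤ LinearMap.ker (T ^ (n + 1)) := by
      rw [pow_succ']
      exact LinearMap.ker_le_ker_comp _ _
    rw [← Submodule.rank_quotient_add_rank
        (Submodule.comap (LinearMap.ker (T ^ (n + 1))).subtype (LinearMap.ker (T ^ n))),
      rank_ker_pow_succ_quotient hT, (Submodule.comapSubtypeEquivOfLe hle).rank_eq, ih]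
    push_cast
    ring

end SurjectiveEndomorphism

/-- A second-order recursion whose leading coefficients are surjective can be solved from any
initial pair of values. -/
theorem exists_seq_of_surjective {E : ℕ → Type*} {F : ℕ → Type*}
    (a : ∀ j, E j → E (j + 1) → E (j + 2) → F j) (w : ∀ j, F j)
    (ha : ∀ j x y, Function.Surjective (a j x y)) (x₀ : E 0) (x₁ : E 1) :
    ∃ u : ∀ j, E j, u 0 = x₀ ∧ u 1 = x₁ ∧ ∀ j, a j (u j) (u (j + 1)) (u (j + 2)) = w j := by
  choose g hg using fun j x y => ha j x y (w j)
  let P : ∀ j, E j × E (j + 1) := fun j =>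
    Nat.rec (motive := fun j => E j × E (j + 1)) (x₀, x₁) (fun j p => (p.2, g j p.1 p.2)) j
  exact ⟨fun j => (P j).1, rfl, rfl, fun j => hg j _ _⟩

theorem generalized_eigenspaces
    (E' : Type) [AddCommGroup E'] [Module ℂ E'] [FiniteDimensional ℂ E']
    (E : ℕ → Type) [∀ i, AddCommGroup (E i)] [∀ i, Module ℂ (E i)]
    [∀ i, FiniteDimensional ℂ (E i)]
    (M : E' →ₗ[ℂ] E') (A : E 0 →ₗ[ℂ] E') (B : E' →ₗ[ℂ] E 0)
    (Mseq : ∀ i, E i →ₗ[ℂ] E i)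
    (Aseq : ∀ i, E (i + 1) →ₗ[ℂ] E i)
    (Bseq : ∀ i, E i →ₗ[ℂ] E (i + 1))
    (Φ : (E' × (∀ i, E i)) →ₗ[ℂ] (E' × (∀ i, E i)))
    (hΦ1 : ∀ v : E' × (∀ i, E i), (Φ v).1 = M v.1 + A (v.2 0))
    (hΦ2 : ∀ v : E' × (∀ i, E i),
      (Φ v).2 0 = B v.1 + Mseq 0 (v.2 0) + Aseq 0 (v.2 1))
    (hΦ3 : ∀ (v : E' × (∀ i, E i)) (j : ℕ),
      (Φ v).2 (j + 1)
        = Bseq j (v.2 j) + Mseq (j + 1) (v.2 (j + 1)) + Aseq (j + 1) (v.2 (j + 2)))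
    (hstrict : ∀ i, Function.Bijective (Aseq i))
    (lam : ℂ) (hlam : ¬ Module.End.HasEigenvalue M lam)
    (k : ℕ) (hk : 1 ≤ k) :
    Module.rank ℂ
        (LinearMap.ker ((Φ - lam • LinearMap.id) ^ k) ⧸
          Submodule.comap (LinearMap.ker ((Φ - lam • LinearMap.id) ^ k)).subtype
            (LinearMap.ker ((Φ - lam • LinearMap.id) ^ (k - 1))))
      = Module.rank ℂ (LinearMap.ker (Φ - lam • LinearMap.id)) ∧
    Module.rank ℂ (LinearMap.ker ((Φ - lam • LinearMap.id) ^ k))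
      = k * Module.rank ℂ (LinearMap.ker (Φ - lam • LinearMap.id)) ∧
    Module.rank ℂ (LinearMap.ker ((Φ - lam • LinearMap.id) ^ k))
      = k * Module.finrank ℂ (E 0) := by
  set T := Φ - lam • LinearMap.id with hTdef
  have hT1 : ∀ v, (T v).1 = (M - lam • (1 : Module.End ℂ E')) v.1 + A (v.2 0) := fun v => by
    simp only [hTdef, LinearMap.sub_apply, LinearMap.smul_apply, LinearMap.id_apply,
      Prod.fst_sub, Prod.smul_fst, hΦ1, Module.End.one_apply]
    abel
  have hT2 : ∀ v, (T v).2 0 = B v.1 + Mseq 0 (v.2 0) - lam • v.2 0 + Aseq 0 (v.2 1) := fun v => by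
    simp only [hTdef, LinearMap.sub_apply, LinearMap.smul_apply, LinearMap.id_apply,
      Prod.snd_sub, Prod.smul_snd, Pi.sub_apply, Pi.smul_apply, hΦ2]
    abel
  have hT3 : ∀ v j, (T v).2 (j + 1) = Bseq j (v.2 j) + Mseq (j + 1) (v.2 (j + 1))
      - lam • v.2 (j + 1) + Aseq (j + 1) (v.2 (j + 2)) := fun v j => by
    simp only [hTdef, LinearMap.sub_apply, LinearMap.smul_apply, LinearMap.id_apply,
      Prod.snd_sub, Prod.smul_snd, Pi.sub_apply, Pi.smul_apply, hΦ3]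
    abel
  have hMinj : Function.Injective (M - lam • (1 : Module.End ℂ E')) := by
    rw [← LinearMap.ker_eq_bot, ← Module.End.eigenspace_def]
    simpa [Module.End.hasEigenvalue_iff] using hlam
  have hMsurj : Function.Surjective (M - lam • (1 : Module.End ℂ E')) :=
    LinearMap.injective_iff_surjective.mp hMinj
  have hex : ∀ (w : E' × (∀ i, E i)) (x₀ : E 0), ∃ v, T v = w ∧ v.2 0 = x₀ := by
    intro w x₀
    obtain ⟨v', hv'⟩ := hMsurj (w.1 - A x₀)
    obtain ⟨x₁, hx₁⟩ := (hstrict 0).2 (w.2 0 - (B v' + Mseq 0 x₀ - lam • x₀))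
    obtain ⟨u, hu0, hu1, hu⟩ := exists_seq_of_surjective
      (fun j x y z => Bseq j x + Mseq (j + 1) y - lam • y + Aseq (j + 1) z)
      (fun j => w.2 (j + 1))
      (fun j x y => (Equiv.addLeft _).surjective.comp (hstrict (j + 1)).2) x₀ x₁
    refine ⟨(v', u), Prod.ext ?_ (funext fun j => ?_), hu0⟩
    · simp only [hT1, hv', hu0, sub_add_cancel]
    · cases j with
      | zero => simp only [hT2, hu0, hu1, hx₁, add_sub_cancel]
      | succ j => rw [hT3]; exact hu j
  have huniq : ∀ v, T v = 0 → v.2 0 = 0 → v = 0 := by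
    intro v hv h0
    have hv1 : v.1 = 0 := hMinj <| by
      rw [map_zero]
      simpa [hv, h0] using (hT1 v).symm
    have hpair : ∀ j, v.2 j = 0 ∧ v.2 (j + 1) = 0 := by
      intro j
      induction j with
      | zero =>
        refine ⟨h0, (hstrict 0).1 ?_⟩
        rw [map_zero]
        simpa [hv, h0, hv1] using (hT2 v).symm
      | succ j ih =>
        refine ⟨ih.2, (hstrict (j + 1)).1 ?_⟩
        rw [map_zero]
        simpa [hv, ih.1, ih.2] using (hT3 v j).symm
    exact Prod.ext hv1 (funext fun j => (hpair j).1)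
  have hTsurj : Function.Surjective T := fun w => (hex w 0).imp fun _ h => h.1
  have hker : Module.rank ℂ (LinearMap.ker T) = Module.finrank ℂ (E 0) := by
    let ev : LinearMap.ker T →ₗ[ℂ] E 0 :=
      (LinearMap.proj 0 ∘ₗ LinearMap.snd ℂ E' (∀ i, E i)).domRestrict _
    have hev : Function.Bijective ev := by
      refine ⟨(injective_iff_map_eq_zero ev).mpr fun v hv => Subtype.ext (huniq v v.2 hv),
        fun x₀ => ?_⟩
      obtain ⟨v, hv, hv0⟩ := hex 0 x₀
      exact ⟨⟨v, hv⟩, hv0⟩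
    rw [(LinearEquiv.ofBijective ev hev).rank_eq, Module.finrank_eq_rank]
  have hrank := rank_ker_pow_of_surjective hTsurj k
  refine ⟨?_, hrank, by rw [hrank, hker]⟩
  obtain ⟨n, rfl⟩ := Nat.exists_eq_add_of_le' hk
  exact rank_ker_pow_succ_quotient hTsurj n
end

section
/- Out-degree of the ramified Hecke graph: In the local setup, assume additionally that k is a finite field with |k| = Q. Then the number of left K_d-cosets contained in the double coset K_d Δ K_d (i.e. the cardinality of K_d Δ K_d / K_d) equals Q^{r(n−r)}. -/
/-!
Local setup: `O = k⟦t⟧` is `PowerSeries k`, `F = k((t))` is `LaurentSeries k`.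
`Delta` is the diagonal matrix with first `r` entries `t` and remaining entries `1`;
`Kd` is the principal congruence subgroup of level `d`, viewed as a set of matrices
over `F`.  Statement: if `k` is finite of cardinality `Q`, the number of left
`K_d`-cosets contained in the double coset `K_d Δ K_d` equals `Q^(r(n-r))`.
-/

noncomputable section

/-- The canonical inclusion `k⟦t⟧ →+* k((t))`. -/
def toF (k : Type) [Field k] : PowerSeries k →+* LaurentSeries k :=
  HahnSeries.ofPowerSeries ℤ k

/-- The diagonal matrix `Δ = diag(t,…,t,1,…,1)` with `r` entries equal to `t`. -/
def Delta (k : Type) [Field k] (n r : ℕ) :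
    Matrix (Fin n) (Fin n) (LaurentSeries k) :=
  Matrix.diagonal (fun i => if (i : ℕ) < r then toF k PowerSeries.X else 1)

/-- The principal congruence subgroup `K_d ⊆ GL_n(O)`, viewed as the set of
matrices over `F = k((t))` that come from a matrix over `O = k⟦t⟧` which is
invertible over `O` and congruent to the identity modulo `t^d`. -/
def Kd (k : Type) [Field k] (n d : ℕ) :
    Set (Matrix (Fin n) (Fin n) (LaurentSeries k)) :=
  { g | ∃ h : Matrix (Fin n) (Fin n) (PowerSeries k),
      (∀ i j, g i j = toF k (h i j)) ∧ IsUnit h.det ∧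
      ∀ i j, (PowerSeries.X : PowerSeries k) ^ d ∣ (h - 1) i j }

section KdLevel

open Matrix PowerSeries

variable {k : Type} [Field k] {n : ℕ}

lemma toF_injective : Function.Injective (toF k) :=
  HahnSeries.ofPowerSeries_injective

lemma isUnit_det_one_add_X_pow_smul {d : ℕ} (hd : 1 ≤ d) (M : Matrix (Fin n) (Fin n) k⟦X⟧) :
    IsUnit (1 + (X : k⟦X⟧) ^ d • M).det := by
  have h : (constantCoeff (R := k)).mapMatrix (1 + (X : k⟦X⟧) ^ d • M) = 1 := by
    ext i j
    have hd0 : d ≠ 0 := by omega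
    simp [Matrix.one_apply, hd0, apply_ite]
  rw [PowerSeries.isUnit_iff_constantCoeff, RingHom.map_det, h, det_one]
  exact isUnit_one

lemma mem_Kd_iff {d : ℕ} (hd : 1 ≤ d) {g : Matrix (Fin n) (Fin n) (LaurentSeries k)} :
    g ∈ Kd k n d ↔ ∃ M : Matrix (Fin n) (Fin n) k⟦X⟧,
      g = (toF k).mapMatrix (1 + (X : k⟦X⟧) ^ d • M) := by
  constructor
  · rintro ⟨h, hg, -, hdvd⟩
    choose M hM using hdvd
    refine ⟨of M, ?_⟩
    have hh : h = 1 + (X : k⟦X⟧) ^ d • of M := by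
      rw [← sub_eq_iff_eq_add']
      ext1 i j
      exact hM i j
    rw [← hh]
    ext1 i j
    exact hg i j
  · rintro ⟨M, rfl⟩
    refine ⟨_, fun i j => rfl, isUnit_det_one_add_X_pow_smul hd M, fun i j => ?_⟩
    rw [add_sub_cancel_left]
    exact ⟨M i j, rfl⟩

lemma one_mem_Kd {d : ℕ} (hd : 1 ≤ d) : 1 ∈ Kd k n d :=
  (mem_Kd_iff hd).2 ⟨0, by simp⟩

lemma mul_mem_Kd {d : ℕ} (hd : 1 ≤ d) {a b : Matrix (Fin n) (Fin n) (LaurentSeries k)}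
    (ha : a ∈ Kd k n d) (hb : b ∈ Kd k n d) : a * b ∈ Kd k n d := by
  obtain ⟨M, rfl⟩ := (mem_Kd_iff hd).1 ha
  obtain ⟨N, rfl⟩ := (mem_Kd_iff hd).1 hb
  refine (mem_Kd_iff hd).2 ⟨M + N + (X : k⟦X⟧) ^ d • (M * N), ?_⟩
  rw [← map_mul]
  congr 1
  simp only [add_mul, mul_add, one_mul, mul_one, smul_mul_assoc, mul_smul_comm, smul_add]
  abel

lemma exists_mul_eq_one_of_mem_Kd {d : ℕ} (hd : 1 ≤ d)
    {a : Matrix (Fin n) (Fin n) (LaurentSeries k)} (ha : a ∈ Kd k n d) :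
    ∃ b ∈ Kd k n d, a * b = 1 := by
  obtain ⟨M, rfl⟩ := (mem_Kd_iff hd).1 ha
  have hu := isUnit_det_one_add_X_pow_smul hd M
  set h := 1 + (X : k⟦X⟧) ^ d • M with hh
  have hinv : h⁻¹ = 1 + (X : k⟦X⟧) ^ d • (-(h⁻¹ * M)) := by
    have := nonsing_inv_mul h hu
    nth_rewrite 2 [hh] at this
    rw [mul_add, mul_one, mul_smul_comm] at this
    rw [smul_neg, ← sub_eq_add_neg, ← this, add_sub_cancel_right]
  refine ⟨(toF k).mapMatrix h⁻¹, (mem_Kd_iff hd).2 ⟨_, congrArg _ hinv⟩, ?_⟩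
  rw [← map_mul, mul_nonsing_inv h hu, map_one]

lemma leftCoset_mul_of_mem_Kd {d : ℕ} (hd : 1 ≤ d)
    (x : Matrix (Fin n) (Fin n) (LaurentSeries k))
    {b : Matrix (Fin n) (Fin n) (LaurentSeries k)} (hb : b ∈ Kd k n d) :
    {y | ∃ c ∈ Kd k n d, y = x * b * c} = {y | ∃ c ∈ Kd k n d, y = x * c} := by
  obtain ⟨b', hb', hbb'⟩ := exists_mul_eq_one_of_mem_Kd hd hb
  ext y
  constructor
  · rintro ⟨c, hc, rfl⟩
    exact ⟨b * c, mul_mem_Kd hd hb hc, mul_assoc _ _ _⟩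
  · rintro ⟨c, hc, rfl⟩
    refine ⟨b' * c, mul_mem_Kd hd hb' hc, ?_⟩
    rw [mul_assoc, ← mul_assoc b, hbb', one_mul]

/-- The matrix `Δ` over `k⟦t⟧`. -/
def integralDelta (k : Type) [Field k] (n r : ℕ) : Matrix (Fin n) (Fin n) k⟦X⟧ :=
  diagonal fun i => if (i : ℕ) < r then X else 1

lemma mapMatrix_integralDelta (r : ℕ) :
    (toF k).mapMatrix (integralDelta k n r) = Delta k n r := by
  simp only [integralDelta, Delta, RingHom.mapMatrix_apply, diagonal_map (map_zero _)]
  congr 1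
  ext1 i
  split_ifs <;> simp

/-- The block matrix `E(C)` with `C` in the upper-right block and zeros elsewhere. -/
def upperRight (r : ℕ) (C : {i : Fin n // (i : ℕ) < r} × {j : Fin n // ¬ (j : ℕ) < r} → k) :
    Matrix (Fin n) (Fin n) k⟦X⟧ :=
  fun i j => if h : (i : ℕ) < r ∧ ¬ (j : ℕ) < r then
    PowerSeries.C (C (⟨i, h.1⟩, ⟨j, h.2⟩)) else 0

lemma upperRight_mul_self (r : ℕ)
    (C : {i : Fin n // (i : ℕ) < r} × {j : Fin n // ¬ (j : ℕ) < r} → k) :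
    upperRight r C * upperRight r C = 0 := by
  ext1 i j
  rw [mul_apply, Matrix.zero_apply]
  refine Finset.sum_eq_zero fun l _ => ?_
  by_cases hl : (l : ℕ) < r <;> simp [upperRight, hl]

lemma exists_integralDelta_mul_eq {r : ℕ} (N : Matrix (Fin n) (Fin n) k⟦X⟧)
    (hN : ∀ i j : Fin n, (i : ℕ) < r → ¬ (j : ℕ) < r → X ∣ N i j) :
    ∃ N', integralDelta k n r * N' = N * integralDelta k n r := by
  have h : ∀ i j : Fin n, ∃ q : k⟦X⟧,
      (if (i : ℕ) < r then X else 1) * q = N i j * (if (j : ℕ) < r then X else 1) := by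
    intro i j
    by_cases hi : (i : ℕ) < r <;> by_cases hj : (j : ℕ) < r
    · exact ⟨N i j, by simp [hi, hj, mul_comm]⟩
    · obtain ⟨q, hq⟩ := hN i j hi hj
      exact ⟨q, by simp [hi, hj, hq]⟩
    · exact ⟨N i j * X, by simp [hi, hj]⟩
    · exact ⟨N i j, by simp [hi, hj]⟩
  choose N' hN' using h
  refine ⟨of N', ?_⟩
  ext1 i j
  rw [integralDelta, diagonal_mul, mul_diagonal]
  exact hN' i j

/-- Every `a ∈ K_d` is congruent to some `I + t^d E(C)` modulo `Δ K_d Δ⁻¹` on the right. -/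
lemma exists_upperRight_of_mem_Kd {r d : ℕ} (hd : 1 ≤ d)
    {a : Matrix (Fin n) (Fin n) (LaurentSeries k)} (ha : a ∈ Kd k n d) :
    ∃ C, ∃ b ∈ Kd k n d, a * Delta k n r =
      (toF k).mapMatrix (1 + (X : k⟦X⟧) ^ d • upperRight r C) * Delta k n r * b := by
  obtain ⟨M, rfl⟩ := (mem_Kd_iff hd).1 ha
  let C : {i : Fin n // (i : ℕ) < r} × {j : Fin n // ¬ (j : ℕ) < r} → k :=
    fun p => constantCoeff (M p.1 p.2)
  set E := upperRight r C with hE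
  set D := integralDelta k n r with hD
  obtain ⟨N', hN'⟩ := exists_integralDelta_mul_eq (r := r) (M - E - (X : k⟦X⟧) ^ d • (E * M)) (by
    intro i j hi hj
    have hd0 : d ≠ 0 := by omega
    rw [X_dvd_iff]
    simp [hE, upperRight, hi, hj, C, hd0])
  refine ⟨C, _, (mem_Kd_iff hd).2 ⟨N', rfl⟩, ?_⟩
  rw [← mapMatrix_integralDelta, ← map_mul, ← map_mul, ← map_mul, mul_assoc]
  congr 1
  rw [← hE, ← hD, mul_add, mul_one, mul_smul_comm, hN', ← smul_mul_assoc]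
  nth_rewrite 2 [← one_mul D]
  rw [← add_mul, ← mul_assoc]
  congr 1
  have hEE : E * E = 0 := upperRight_mul_self r C
  simp only [add_mul, mul_add, mul_sub, one_mul, mul_one, smul_mul_assoc, mul_smul_comm, smul_sub,
    smul_add, hEE, ← mul_assoc E E, zero_mul, smul_zero]
  abel

lemma upperRight_injective_of_mul_eq {r d : ℕ} (hd : 1 ≤ d)
    {C C' : {i : Fin n // (i : ℕ) < r} × {j : Fin n // ¬ (j : ℕ) < r} → k}
    {b : Matrix (Fin n) (Fin n) (LaurentSeries k)} (hb : b ∈ Kd k n d)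
    (h : (toF k).mapMatrix (1 + (X : k⟦X⟧) ^ d • upperRight r C) * Delta k n r =
      (toF k).mapMatrix (1 + (X : k⟦X⟧) ^ d • upperRight r C') * Delta k n r * b) :
    C = C' := by
  obtain ⟨M, rfl⟩ := (mem_Kd_iff hd).1 hb
  rw [← mapMatrix_integralDelta, ← map_mul, ← map_mul, ← map_mul] at h
  replace h := Matrix.map_injective toF_injective h
  set D := integralDelta k n r with hD
  have h' : (X : k⟦X⟧) ^ d • (upperRight r C * D) = (X : k⟦X⟧) ^ d •
      (upperRight r C' * D + D * M + (X : k⟦X⟧) ^ d • (upperRight r C' * D * M)) := by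
    simp only [add_mul, mul_add, one_mul, mul_one, smul_mul_assoc, mul_smul_comm, smul_add] at h
    simp only [smul_add]
    refine add_left_cancel (a := D) (h.trans ?_)
    abel
  ext ⟨i, j⟩
  have hij := congrFun (congrFun h' i) j
  rw [Matrix.smul_apply, Matrix.smul_apply, smul_eq_mul, smul_eq_mul] at hij
  replace hij := mul_left_cancel₀ (pow_ne_zero d X_ne_zero) hij
  have hd0 : d ≠ 0 := by omega
  replace hij := congrArg constantCoeff hij
  simpa [hD, integralDelta, diagonal_mul, mul_diagonal, upperRight, i.2, j.2, hd0] using hij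

lemma card_fin_subtype_lt {r : ℕ} (hr : r ≤ n) :
    Fintype.card {i : Fin n // (i : ℕ) < r} = r := by
  rw [Fintype.card_subtype]
  simpa [hr] using Fin.card_filter_val_lt (n := n) (m := r)

end KdLevel

/-- The out-degree of the ramified Hecke graph: the number of left `K_d`-cosets
contained in the double coset `K_d Δ K_d` is `|k|^(r(n-r))`. -/
theorem ramified_hecke_outdegree
    (k : Type) [Field k] [Fintype k] (n r d : ℕ)
    (hn : 1 ≤ n) (hr : r ≤ n) (hd : 1 ≤ d) :
    Nat.card {s : Set (Matrix (Fin n) (Fin n) (LaurentSeries k)) //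
        ∃ x : Matrix (Fin n) (Fin n) (LaurentSeries k),
          (∃ a ∈ Kd k n d, ∃ b ∈ Kd k n d, x = a * Delta k n r * b) ∧
          s = { y | ∃ b ∈ Kd k n d, y = x * b } }
      = Fintype.card k ^ (r * (n - r)) := by
  classical
  have hc : Fintype.card ({i : Fin n // (i : ℕ) < r} × {j : Fin n // ¬ (j : ℕ) < r} → k) =
      Fintype.card k ^ (r * (n - r)) := by
    rw [Fintype.card_fun, Fintype.card_prod, Fintype.card_subtype_compl, card_fin_subtype_lt hr,
      Fintype.card_fin]
  rw [← hc, ← Nat.card_eq_fintype_card]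
  symm
  let rep (C : {i : Fin n // (i : ℕ) < r} × {j : Fin n // ¬ (j : ℕ) < r} → k) :=
    (toF k).mapMatrix (1 + (PowerSeries.X : PowerSeries k) ^ d • upperRight r C)
  refine Nat.card_eq_of_bijective (fun C => ⟨{y | ∃ b ∈ Kd k n d, y = rep C * Delta k n r * b},
    rep C * Delta k n r, ⟨rep C, (mem_Kd_iff hd).2 ⟨_, rfl⟩, 1, one_mem_Kd hd,
      (mul_one _).symm⟩, rfl⟩) ⟨?_, ?_⟩
  · intro C C' h
    have hmem : rep C * Delta k n r ∈ {y | ∃ b ∈ Kd k n d, y = rep C' * Delta k n r * b} := by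
      refine (Subtype.ext_iff.1 h).subset ?_
      exact ⟨1, one_mem_Kd hd, (mul_one _).symm⟩
    obtain ⟨b, hb, hb'⟩ := hmem
    exact upperRight_injective_of_mul_eq hd hb hb'
  · rintro ⟨_, _, ⟨a, ha, b, hb, rfl⟩, rfl⟩
    obtain ⟨C, c, hc, hC⟩ := exists_upperRight_of_mem_Kd (r := r) hd ha
    refine ⟨C, Subtype.ext ?_⟩
    change {y | ∃ c ∈ Kd k n d, y = rep C * Delta k n r * c} =
      {y | ∃ c ∈ Kd k n d, y = a * Delta k n r * b * c}
    rw [leftCoset_mul_of_mem_Kd hd _ hb, hC, leftCoset_mul_of_mem_Kd hd _ hc]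
end
end

section
/- Scalar rigidity of the twisted congruence subgroup (key step from GL_n to PGL_n): In the local setup, assume 1 ≤ r. If p ∈ K_d and ζ ∈ F^× are such that Δ^{-1} p Δ · (ζ·I_n) ∈ K_d, then ζ ∈ O and ζ ≡ 1 (mod t^d); in particular ζ·I_n ∈ K_d. Equivalently, (Δ^{-1} K_d Δ · {ζ·I_n : ζ ∈ F^×}) ∩ K_d = (Δ^{-1} K_d Δ) ∩ K_d. -/
/-!
Local setup: `O = k⟦t⟧` is `PowerSeries k`, `F = k((t))` is `LaurentSeries k`.
`Delta` is the diagonal matrix with first `r` entries `t` and remaining entries `1`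
(`DeltaInv` is its inverse); `Kd` is the principal congruence subgroup of level `d`.
Statement (scalar rigidity, `1 ≤ r`): if `p ∈ K_d` and `ζ ∈ F^×` are such that
`Δ⁻¹ p Δ · (ζ·1) ∈ K_d`, then `ζ ∈ O` with `ζ ≡ 1 (mod t^d)`, so `ζ·1 ∈ K_d`;
equivalently `(Δ⁻¹ K_d Δ · F^×·1) ∩ K_d = (Δ⁻¹ K_d Δ) ∩ K_d`.
-/

noncomputable section

/-- The inverse `Δ⁻¹ = diag(t⁻¹,…,t⁻¹,1,…,1)` of `Delta`. -/
def DeltaInv (k : Type) [Field k] (n r : ℕ) :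
    Matrix (Fin n) (Fin n) (LaurentSeries k) :=
  Matrix.diagonal (fun i => if (i : ℕ) < r then (toF k PowerSeries.X)⁻¹ else 1)

theorem PowerSeries.isUnit_of_X_pow_dvd_sub_one {k : Type} [Field k] {d : ℕ} (hd : 1 ≤ d)
    {z : PowerSeries k} (h : (PowerSeries.X : PowerSeries k) ^ d ∣ z - 1) : IsUnit z := by
  have h1 : (PowerSeries.X : PowerSeries k) ∣ z - 1 := (dvd_pow_self _ (by omega)).trans h
  rw [PowerSeries.X_dvd_iff, map_sub, map_one, sub_eq_zero] at h1
  rw [PowerSeries.isUnit_iff_constantCoeff, h1]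
  exact isUnit_one

theorem Kd_mul_mem {k : Type} [Field k] {n d : ℕ}
    {a b : Matrix (Fin n) (Fin n) (LaurentSeries k)} (ha : a ∈ Kd k n d) (hb : b ∈ Kd k n d) :
    a * b ∈ Kd k n d := by
  obtain ⟨g, hg, hgu, hgd⟩ := ha
  obtain ⟨h, hh, hhu, hhd⟩ := hb
  refine ⟨g * h, fun i j => ?_, ?_, fun i j => ?_⟩
  · simp [Matrix.mul_apply, hg, hh]
  · rw [Matrix.det_mul]
    exact hgu.mul hhu
  · rw [show g * h - 1 = (g - 1) * h + (h - 1) by noncomm_ring, Matrix.add_apply,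
      Matrix.mul_apply]
    exact dvd_add (Finset.dvd_sum fun l _ => (hgd i l).mul_right _) (hhd i j)

theorem smul_one_mem_Kd {k : Type} [Field k] {n d : ℕ} (hd : 1 ≤ d) {z : PowerSeries k}
    (h : (PowerSeries.X : PowerSeries k) ^ d ∣ z - 1) :
    toF k z • (1 : Matrix (Fin n) (Fin n) (LaurentSeries k)) ∈ Kd k n d := by
  refine ⟨z • 1, fun i j => ?_, ?_, fun i j => ?_⟩
  · by_cases hij : i = j <;> simp [hij]
  · simpa using (PowerSeries.isUnit_of_X_pow_dvd_sub_one hd h).pow n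
  · by_cases hij : i = j <;> simp [hij, h]

theorem DeltaInv_mul_mul_Delta_apply_self {k : Type} [Field k] {n r : ℕ}
    (p : Matrix (Fin n) (Fin n) (LaurentSeries k)) (i : Fin n) :
    (DeltaInv k n r * p * Delta k n r) i i = p i i := by
  have hX : toF k PowerSeries.X ≠ 0 :=
    (map_ne_zero_iff _ HahnSeries.ofPowerSeries_injective).mpr PowerSeries.X_ne_zero
  rw [DeltaInv, Delta, Matrix.mul_diagonal, Matrix.diagonal_mul]
  split_ifs
  · field_simp
  · simp

theorem exists_toF_eq_of_twist_mem {k : Type} [Field k] {n r d : ℕ} (hn : 1 ≤ n) (hd : 1 ≤ d)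
    {p : Matrix (Fin n) (Fin n) (LaurentSeries k)} (hp : p ∈ Kd k n d) {ζ : LaurentSeries k}
    (h : DeltaInv k n r * p * Delta k n r
      * (ζ • (1 : Matrix (Fin n) (Fin n) (LaurentSeries k))) ∈ Kd k n d) :
    ∃ z : PowerSeries k, toF k z = ζ ∧ (PowerSeries.X : PowerSeries k) ^ d ∣ z - 1 := by
  obtain ⟨g, hg, -, hgd⟩ := hp
  obtain ⟨q, hq, -, hqd⟩ := h
  let i : Fin n := ⟨0, hn⟩
  have hgi := hgd i i
  have hqi := hqd i i
  rw [Matrix.sub_apply, Matrix.one_apply_eq] at hgi hqi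
  have hqe := hq i i
  rw [Matrix.mul_smul, Matrix.mul_one, Matrix.smul_apply, DeltaInv_mul_mul_Delta_apply_self,
    hg, smul_eq_mul] at hqe
  obtain ⟨v, hv⟩ := (PowerSeries.isUnit_of_X_pow_dvd_sub_one hd hgi).exists_right_inv
  refine ⟨q i i * v, ?_, ?_⟩
  · rw [map_mul, ← hqe, mul_assoc, ← map_mul, hv, map_one, mul_one]
  · rw [show q i i * v - 1 = ((q i i - 1) - (g i i - 1)) * v by linear_combination hv]
    exact (dvd_sub hqi hgi).mul_right _

/-- Scalar rigidity of the twisted congruence subgroup. -/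
theorem scalar_rigidity
    (k : Type) [Field k] (n r d : ℕ)
    (hn : 1 ≤ n) (hr1 : 1 ≤ r) (hr : r ≤ n) (hd : 1 ≤ d) :
    (∀ p ∈ Kd k n d, ∀ ζ : LaurentSeries k, ζ ≠ 0 →
      DeltaInv k n r * p * Delta k n r
          * (ζ • (1 : Matrix (Fin n) (Fin n) (LaurentSeries k))) ∈ Kd k n d →
      (∃ z : PowerSeries k, toF k z = ζ ∧
          (PowerSeries.X : PowerSeries k) ^ d ∣ (z - 1)) ∧
      ζ • (1 : Matrix (Fin n) (Fin n) (LaurentSeries k)) ∈ Kd k n d) ∧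
    ({ x | ∃ p ∈ Kd k n d, ∃ ζ : LaurentSeries k, ζ ≠ 0 ∧
        x = DeltaInv k n r * p * Delta k n r
              * (ζ • (1 : Matrix (Fin n) (Fin n) (LaurentSeries k))) } ∩ Kd k n d
      = { x | ∃ p ∈ Kd k n d, x = DeltaInv k n r * p * Delta k n r } ∩ Kd k n d) := by
  refine ⟨fun p hp ζ _ h => ?_, ?_⟩
  · obtain ⟨z, rfl, hz⟩ := exists_toF_eq_of_twist_mem hn hd hp h
    exact ⟨⟨z, rfl, hz⟩, smul_one_mem_Kd hd hz⟩
  · ext x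
    constructor
    · rintro ⟨⟨p, hp, ζ, -, rfl⟩, h⟩
      obtain ⟨z, rfl, hz⟩ := exists_toF_eq_of_twist_mem hn hd hp h
      exact ⟨⟨_, Kd_mul_mem hp (smul_one_mem_Kd hd hz), by simp⟩, h⟩
    · rintro ⟨⟨p, hp, rfl⟩, h⟩
      exact ⟨⟨p, hp, 1, one_ne_zero, by simp⟩, h⟩
end
end
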